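/- (Recurrence relation for the first sequence.) Let N ≥ 2. If N is even, then E_{μ_{N,0}}[a] = (μ_{N−1,0}(Γ)/μ_{N,0}(Γ)) · ( (m+n+1)·E_{μ_{N−1,0}}[a] + ( m(m+2) + (N−2)(m+n)(m+n+2) )/6 ). If N is odd, then E_{μ_{N,0}}[b] = (μ_{N−1,0}(Γ)/μ_{N,0}(Γ)) · ( (m+n+1)·E_{μ_{N−1,0}}[b] + ( m(m+2) + (N−2)(m+n)(m+n+2) )/6 ). -/

import Mathlib

open Finsupp Filter

noncomputable section

/-- Signed-sum convention: `signedSum c k = Σ_{i=0}^{k} c i`, which is the ordinary sum for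
`k ≥ 0`, is `0` for `k = -1`, and equals `-(c (-1) + c (-2) + ⋯ + c (k+1))` for `k ≤ -2`. -/
def signedSum {M : Type*} [AddCommGroup M] (c : ℤ → M) (k : ℤ) : M :=
  (∑ i ∈ Finset.range (k + 1).toNat, c i) -
    ∑ i ∈ Finset.range (-(k + 1)).toNat, c (-((i : ℤ) + 1))

/-- The Demazure operator `D₀` (relative to `Λ = mΛ₀ + nΛ₁`):
`D₀ δ_{(a,b)} = Σ_{i=0}^{m - 2(a-b)} δ_{(a+i,b)}`, extended ℤ-linearly. -/
def D0 (m : ℕ) (μ : ℤ × ℤ →₀ ℤ) : ℤ × ℤ →₀ ℤ :=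
  μ.sum fun p c =>
    c • signedSum (fun i => Finsupp.single (p.1 + i, p.2) (1 : ℤ)) ((m : ℤ) - 2 * (p.1 - p.2))

/-- The Demazure operator `D₁` (relative to `Λ = mΛ₀ + nΛ₁`):
`D₁ δ_{(a,b)} = Σ_{i=0}^{n + 2(a-b)} δ_{(a,b+i)}`, extended ℤ-linearly. -/
def D1 (n : ℕ) (μ : ℤ × ℤ →₀ ℤ) : ℤ × ℤ →₀ ℤ :=
  μ.sum fun p c =>
    c • signedSum (fun i => Finsupp.single (p.1, p.2 + i) (1 : ℤ)) ((n : ℤ) + 2 * (p.1 - p.2))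

/-- Total mass `μ(Γ)` of a finitely supported function on `ℤ × ℤ`. -/
def mass (μ : ℤ × ℤ →₀ ℤ) : ℤ := μ.sum fun _ c => c

/-- Expected value `E_ν[f] = (1/ν(Γ)) Σ ν(a,b) f(a,b)`. -/
def expVal (ν : ℤ × ℤ →₀ ℤ) (f : ℤ × ℤ → ℚ) : ℚ :=
  (mass ν : ℚ)⁻¹ * ν.sum fun p c => (c : ℚ) * f p

/-- Covariance `Cov_ν(f,g) = E_ν[f·g] - E_ν[f]·E_ν[g]`. -/
def cov (ν : ℤ × ℤ →₀ ℤ) (f g : ℤ × ℤ → ℚ) : ℚ :=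
  expVal ν (fun p => f p * g p) - expVal ν f * expVal ν g

/-- Variance `Var_ν(f) = Cov_ν(f,f)`. -/
def var (ν : ℤ × ℤ →₀ ℤ) (f : ℤ × ℤ → ℚ) : ℚ := cov ν f f

/-- The coordinate function `a` (the degree). -/
def fa : ℤ × ℤ → ℚ := fun p => (p.1 : ℚ)

/-- The coordinate function `b`. -/
def fb : ℤ × ℤ → ℚ := fun p => (p.2 : ℚ)

/-- The finite-weight coordinate `a - b`. -/
def fab : ℤ × ℤ → ℚ := fun p => (p.1 : ℚ) - (p.2 : ℚ)

/-- `μ_{N,0}`: start from `δ_{(0,0)}`, apply `D₀` at odd steps and `D₁` at even steps. -/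
def mu0 (m n : ℕ) : ℕ → (ℤ × ℤ →₀ ℤ)
  | 0 => Finsupp.single (0, 0) 1
  | N + 1 => if N % 2 = 0 then D0 m (mu0 m n N) else D1 n (mu0 m n N)

/-- `μ_{N,1}`: start from `δ_{(0,0)}`, apply `D₁` at odd steps and `D₀` at even steps. -/
def mu1 (m n : ℕ) : ℕ → (ℤ × ℤ →₀ ℤ)
  | 0 => Finsupp.single (0, 0) 1
  | N + 1 => if N % 2 = 0 then D1 n (mu1 m n N) else D0 m (mu1 m n N)

/-- The bilinear pairing `Σ ν(p) f(p)`, as a linear functional of `f`. -/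
def pairing (ν : ℤ × ℤ →₀ ℤ) : (ℤ × ℤ → ℚ) →ₗ[ℚ] ℚ :=
  ν.sum fun p c => (c : ℚ) • LinearMap.proj p

theorem pairing_apply (ν : ℤ × ℤ →₀ ℤ) (f : ℤ × ℤ → ℚ) :
    pairing ν f = ν.sum fun p c => (c : ℚ) * f p := by
  simp [pairing, Finsupp.sum, LinearMap.sum_apply]

theorem pairing_one (ν : ℤ × ℤ →₀ ℤ) : pairing ν 1 = mass ν := by
  simp [pairing_apply, mass, Finsupp.sum]

theorem expVal_eq_pairing (ν : ℤ × ℤ →₀ ℤ) (f : ℤ × ℤ → ℚ) :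
    expVal ν f = (mass ν : ℚ)⁻¹ * pairing ν f := by
  rw [pairing_apply, expVal]

/-- The pairing with a fixed function, as an additive map of the finitely supported argument. -/
def pairingHom (f : ℤ × ℤ → ℚ) : (ℤ × ℤ →₀ ℤ) →+ ℚ :=
  Finsupp.liftAddHom fun p => (AddMonoidHom.mulRight (f p)).comp (Int.castAddHom ℚ)

theorem pairingHom_apply (f : ℤ × ℤ → ℚ) (ν : ℤ × ℤ →₀ ℤ) : pairingHom f ν = pairing ν f := by
  rw [pairing_apply]
  rfl

theorem pairing_single (p : ℤ × ℤ) (f : ℤ × ℤ → ℚ) : pairing (Finsupp.single p 1) f = f p := by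
  simp [pairing_apply]

theorem map_signedSum {M P : Type*} [AddCommGroup M] [AddCommGroup P] (φ : M →+ P) (c : ℤ → M)
    (k : ℤ) : φ (signedSum c k) = signedSum (fun i => φ (c i)) k := by
  simp [signedSum]

theorem signedSum_eq_sub {M : Type*} [AddCommGroup M] {c F : ℤ → M}
    (h : ∀ i, F (i + 1) - F i = c i) (k : ℤ) : signedSum c k = F (k + 1) - F 0 := by
  have hpos (j : ℕ) : ∑ i ∈ Finset.range j, c i = F j - F 0 := by
    simpa [← h] using Finset.sum_range_sub (fun i : ℕ => F i) j
  have hneg (j : ℕ) : ∑ i ∈ Finset.range j, c (-((i : ℤ) + 1)) = F 0 - F (-j) := by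
    have := Finset.sum_range_sub' (fun i : ℕ => F (-i)) j
    simpa [← h, add_comm] using this
  rw [signedSum, hpos, hneg]
  rcases le_total 0 (k + 1) with hk | hk
  · have : (-(k + 1)).toNat = 0 := by omega
    rw [this, Int.toNat_of_nonneg hk]
    simp
  · have : (k + 1).toNat = 0 := by omega
    rw [this, Int.toNat_of_nonneg (by omega)]
    simp

theorem pairing_D0 (m : ℕ) (μ : ℤ × ℤ →₀ ℤ) (f : ℤ × ℤ → ℚ) :
    pairing (D0 m μ) f = pairing μ fun p =>
      signedSum (fun i => f (p.1 + i, p.2)) ((m : ℤ) - 2 * (p.1 - p.2)) := by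
  rw [← pairingHom_apply, D0, Finsupp.sum, map_sum, pairing_apply, Finsupp.sum]
  refine Finset.sum_congr rfl fun p _ => ?_
  rw [map_zsmul, map_signedSum, zsmul_eq_mul]
  simp only [pairingHom_apply, pairing_single]

theorem pairing_D1 (n : ℕ) (μ : ℤ × ℤ →₀ ℤ) (f : ℤ × ℤ → ℚ) :
    pairing (D1 n μ) f = pairing μ fun p =>
      signedSum (fun i => f (p.1, p.2 + i)) ((n : ℤ) + 2 * (p.1 - p.2)) := by
  rw [← pairingHom_apply, D1, Finsupp.sum, map_sum, pairing_apply, Finsupp.sum]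
  refine Finset.sum_congr rfl fun p _ => ?_
  rw [map_zsmul, map_signedSum, zsmul_eq_mul]
  simp only [pairingHom_apply, pairing_single]

theorem signedSum_const (x : ℚ) (k : ℤ) : signedSum (fun _ => x) k = x * (k + 1) := by
  rw [signedSum_eq_sub (F := fun j => x * j) (fun i => by push_cast; ring)]
  push_cast; ring

theorem signedSum_string (k : ℤ) : signedSum (fun i => (k : ℚ) - 2 * i) k = 0 := by
  rw [signedSum_eq_sub (F := fun j => (j : ℚ) * (k + 1 - j)) (fun i => by push_cast; ring)]
  push_cast; ring

theorem signedSum_string_sq (k : ℤ) :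
    signedSum (fun i => ((k : ℚ) - 2 * i) ^ 2) k = ((k + 1 : ℚ) ^ 3 - (k + 1)) / 3 := by
  rw [signedSum_eq_sub
    (F := fun j => (j : ℚ) * k ^ 2 - 2 * k * j * (j - 1) + 2 * j * (j - 1) * (2 * j - 1) / 3)
    (fun i => by push_cast; ring)]
  push_cast; ring

theorem signedSum_string_cube (k : ℤ) : signedSum (fun i => ((k : ℚ) - 2 * i) ^ 3) k = 0 := by
  rw [signedSum_eq_sub
    (F := fun j => (j : ℚ) * (k + 1 - j) * (((k + 1) ^ 2 + (k + 1 - 2 * j) ^ 2) / 2 - 1))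
    (fun i => by push_cast; ring)]
  push_cast; ring

theorem signedSum_mul_left (x : ℚ) (c : ℤ → ℚ) (k : ℤ) :
    signedSum (fun i => x * c i) k = x * signedSum c k :=
  (map_signedSum (AddMonoidHom.mulLeft x) c k).symm

/-- The pairing of a weight with `-α₀∨`. -/
def negCoroot0 (m : ℕ) : ℤ × ℤ → ℚ := fun p => 2 * (p.1 - p.2) - m

/-- The pairing of a weight with `α₁∨`. -/
def coroot1 (n : ℕ) : ℤ × ℤ → ℚ := fun p => 2 * (p.1 - p.2) + n

/-- `ν` has nonzero mass, the odd moments of `w` up to the third and the mixed moment of `g` and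
`w` vanish, and the second moment of `w` is `V`. -/
structure HasMoments (ν : ℤ × ℤ →₀ ℤ) (w g : ℤ × ℤ → ℚ) (V : ℚ) : Prop where
  mass_ne_zero : (mass ν : ℚ) ≠ 0
  first : pairing ν w = 0
  second : pairing ν (w ^ 2) = V * mass ν
  third : pairing ν (w ^ 3) = 0
  cross : pairing ν (g * w) = 0

theorem pairing_D0_one (m : ℕ) (μ : ℤ × ℤ →₀ ℤ) :
    pairing (D0 m μ) 1 = pairing μ fun p => 1 - negCoroot0 m p := by
  rw [pairing_D0]
  congr 1; ext p
  simp only [Pi.one_apply, signedSum_const, negCoroot0]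
  push_cast; ring

theorem pairing_D1_one (n : ℕ) (μ : ℤ × ℤ →₀ ℤ) :
    pairing (D1 n μ) 1 = pairing μ fun p => 1 + coroot1 n p := by
  rw [pairing_D1]
  congr 1; ext p
  simp only [Pi.one_apply, signedSum_const, coroot1]
  push_cast; ring

theorem negCoroot0_add_left (m : ℕ) (p : ℤ × ℤ) (i : ℤ) :
    negCoroot0 m (p.1 + i, p.2) = -1 * ((((m : ℤ) - 2 * (p.1 - p.2) : ℤ) : ℚ) - 2 * i) := by
  simp only [negCoroot0]; push_cast; ring

theorem coroot1_add_right (n : ℕ) (p : ℤ × ℤ) (i : ℤ) :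
    coroot1 n (p.1, p.2 + i) = (((n : ℤ) + 2 * (p.1 - p.2) : ℤ) : ℚ) - 2 * i := by
  simp only [coroot1]; push_cast; ring

theorem pairing_D0_sq (m : ℕ) (μ : ℤ × ℤ →₀ ℤ) :
    pairing (D0 m μ) (negCoroot0 m ^ 2) =
      pairing μ fun p => ((1 - negCoroot0 m p) ^ 3 - (1 - negCoroot0 m p)) / 3 := by
  rw [pairing_D0]
  congr 1; ext p
  simp only [Pi.pow_apply, negCoroot0_add_left, mul_pow, signedSum_mul_left, signedSum_string_sq]
  simp only [negCoroot0]
  push_cast; ring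

theorem pairing_D1_sq (n : ℕ) (μ : ℤ × ℤ →₀ ℤ) :
    pairing (D1 n μ) (coroot1 n ^ 2) =
      pairing μ fun p => ((1 + coroot1 n p) ^ 3 - (1 + coroot1 n p)) / 3 := by
  rw [pairing_D1]
  congr 1; ext p
  simp only [Pi.pow_apply, coroot1_add_right, signedSum_string_sq]
  simp only [coroot1]
  push_cast; ring

theorem hasMoments_D0 {m : ℕ} {μ : ℤ × ℤ →₀ ℤ} {V : ℚ} (h0 : (mass (D0 m μ) : ℚ) ≠ 0)
    (h2 : pairing (D0 m μ) (negCoroot0 m ^ 2) = V * mass (D0 m μ)) :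
    HasMoments (D0 m μ) (negCoroot0 m) fb V where
  mass_ne_zero := h0
  second := h2
  first := by
    simp only [pairing_D0, negCoroot0_add_left, signedSum_mul_left, signedSum_string, mul_zero]
    exact map_zero _
  third := by
    simp only [pairing_D0, Pi.pow_apply, negCoroot0_add_left, mul_pow, signedSum_mul_left,
      signedSum_string_cube, mul_zero]
    exact map_zero _
  cross := by
    simp only [pairing_D0, Pi.mul_apply, fb, negCoroot0_add_left, signedSum_mul_left,
      signedSum_string, mul_zero]
    exact map_zero _

theorem hasMoments_D1 {n : ℕ} {μ : ℤ × ℤ →₀ ℤ} {V : ℚ} (h0 : (mass (D1 n μ) : ℚ) ≠ 0)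
    (h2 : pairing (D1 n μ) (coroot1 n ^ 2) = V * mass (D1 n μ)) :
    HasMoments (D1 n μ) (coroot1 n) fa V where
  mass_ne_zero := h0
  second := h2
  first := by
    simp only [pairing_D1, coroot1_add_right, signedSum_string]
    exact map_zero _
  third := by
    simp only [pairing_D1, Pi.pow_apply, coroot1_add_right, signedSum_string_cube]
    exact map_zero _
  cross := by
    simp only [pairing_D1, Pi.mul_apply, fa, coroot1_add_right, signedSum_mul_left,
      signedSum_string, mul_zero]
    exact map_zero _

theorem HasMoments.pairing_cubic {ν : ℤ × ℤ →₀ ℤ} {w g : ℤ × ℤ → ℚ} {V : ℚ}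
    (h : HasMoments ν w g V) {f : ℤ × ℤ → ℚ} (c₀ c₁ c₂ c₃ : ℚ)
    (hf : ∀ p, f p = c₀ + c₁ * w p + c₂ * w p ^ 2 + c₃ * w p ^ 3) :
    pairing ν f = (c₀ + c₂ * V) * mass ν := by
  have : f = c₀ • 1 + c₁ • w + c₂ • w ^ 2 + c₃ • w ^ 3 := by
    ext p; simp [hf]
  rw [this]
  simp only [map_add, map_smul, h.first, h.second, h.third, pairing_one, smul_eq_mul]
  ring

theorem HasMoments.D0 {m n : ℕ} {ν : ℤ × ℤ →₀ ℤ} {V : ℚ}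
    (h : HasMoments ν (coroot1 n) fa V) :
    HasMoments (D0 m ν) (negCoroot0 m) fb (V + ((m : ℚ) + n) * (m + n + 2) / 3) := by
  have hmass : (mass (_root_.D0 m ν) : ℚ) = (m + n + 1) * mass ν := by
    rw [← pairing_one, pairing_D0_one, h.pairing_cubic (m + n + 1) (-1) 0 0]
    · ring
    · intro p; simp only [negCoroot0, coroot1]; ring
  apply hasMoments_D0
  · rw [hmass]
    exact mul_ne_zero (by positivity) h.mass_ne_zero
  · rw [pairing_D0_sq, hmass, h.pairing_cubic (((m + n + 1) ^ 3 - (m + n + 1)) / 3)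
      (-(m + n + 1) ^ 2 + 1 / 3) (m + n + 1) (-1 / 3)]
    · ring
    · intro p; simp only [negCoroot0, coroot1]; ring

theorem HasMoments.D1 {m n : ℕ} {ν : ℤ × ℤ →₀ ℤ} {V : ℚ}
    (h : HasMoments ν (negCoroot0 m) fb V) :
    HasMoments (D1 n ν) (coroot1 n) fa (V + ((m : ℚ) + n) * (m + n + 2) / 3) := by
  have hmass : (mass (_root_.D1 n ν) : ℚ) = (m + n + 1) * mass ν := by
    rw [← pairing_one, pairing_D1_one, h.pairing_cubic (m + n + 1) 1 0 0]
    · ring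
    · intro p; simp only [negCoroot0, coroot1]; ring
  apply hasMoments_D1
  · rw [hmass]
    exact mul_ne_zero (by positivity) h.mass_ne_zero
  · rw [pairing_D1_sq, hmass, h.pairing_cubic (((m + n + 1) ^ 3 - (m + n + 1)) / 3)
      ((m + n + 1) ^ 2 - 1 / 3) (m + n + 1) (1 / 3)]
    · ring
    · intro p; simp only [negCoroot0, coroot1]; ring

theorem HasMoments.pairing_D1_fa {m n : ℕ} {ν : ℤ × ℤ →₀ ℤ} {V : ℚ}
    (h : HasMoments ν (negCoroot0 m) fb V) :
    pairing (_root_.D1 n ν) fa = (m + n + 1) * pairing ν fa + V / 2 * mass ν := by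
  have : (fun p : ℤ × ℤ => signedSum (fun i => fa (p.1, p.2 + i)) ((n : ℤ) + 2 * (p.1 - p.2))) =
      ((m : ℚ) + n + 1) • fa + (1 / 2 : ℚ) • negCoroot0 m ^ 2 + (m / 2 : ℚ) • negCoroot0 m +
        fb * negCoroot0 m := by
    ext p
    simp only [fa, fb, signedSum_const, Pi.add_apply, Pi.smul_apply, Pi.mul_apply, Pi.pow_apply,
      negCoroot0, smul_eq_mul]
    push_cast; ring
  rw [pairing_D1, this]
  simp only [map_add, map_smul, h.first, h.second, h.cross, smul_eq_mul]
  ring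

theorem HasMoments.pairing_D0_fb {m n : ℕ} {ν : ℤ × ℤ →₀ ℤ} {V : ℚ}
    (h : HasMoments ν (coroot1 n) fa V) :
    pairing (_root_.D0 m ν) fb = (m + n + 1) * pairing ν fb + V / 2 * mass ν := by
  have : (fun p : ℤ × ℤ => signedSum (fun i => fb (p.1 + i, p.2)) ((m : ℤ) - 2 * (p.1 - p.2))) =
      ((m : ℚ) + n + 1) • fb + (1 / 2 : ℚ) • coroot1 n ^ 2 + (-n / 2 : ℚ) • coroot1 n -
        fa * coroot1 n := by
    ext p
    simp only [fa, fb, signedSum_const, Pi.add_apply, Pi.sub_apply, Pi.smul_apply, Pi.mul_apply,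
      Pi.pow_apply, coroot1, smul_eq_mul]
    push_cast; ring
  rw [pairing_D0, this]
  simp only [map_add, map_sub, map_smul, h.first, h.second, h.cross, smul_eq_mul]
  ring

theorem mu0_odd (m n k : ℕ) : mu0 m n (2 * k + 1) = D0 m (mu0 m n (2 * k)) := by
  simp [mu0]

theorem mu0_even (m n k : ℕ) : mu0 m n (2 * k + 2) = D1 n (mu0 m n (2 * k + 1)) := by
  rw [mu0, if_neg (by omega)]

theorem hasMoments_mu0_one (m n : ℕ) :
    HasMoments (mu0 m n 1) (negCoroot0 m) fb ((m : ℚ) * (m + 2) / 3) := by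
  have hmu : mu0 m n 1 = D0 m (Finsupp.single (0, 0) 1) := by simp [mu0]
  have hmass : (mass (D0 m (Finsupp.single (0, 0) 1)) : ℚ) = m + 1 := by
    rw [← pairing_one, pairing_D0_one, pairing_single, negCoroot0]
    push_cast; ring
  rw [hmu]
  apply hasMoments_D0
  · rw [hmass]; positivity
  · rw [hmass, pairing_D0_sq, pairing_single, negCoroot0]
    push_cast; ring

theorem hasMoments_mu0_odd (m n k : ℕ) :
    HasMoments (mu0 m n (2 * k + 1)) (negCoroot0 m) fb
      (((m : ℚ) * (m + 2) + 2 * k * (m + n) * (m + n + 2)) / 3) := by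
  induction k with
  | zero => simpa using hasMoments_mu0_one m n
  | succ k ih =>
    have h := (ih.D1 (n := n)).D0 (m := m)
    rw [← mu0_even] at h
    rw [mu0_odd, mul_add_one]
    convert h using 1
    push_cast; ring

theorem hasMoments_mu0_even (m n k : ℕ) :
    HasMoments (mu0 m n (2 * k + 2)) (coroot1 n) fa
      (((m : ℚ) * (m + 2) + (2 * k + 1) * (m + n) * (m + n + 2)) / 3) := by
  rw [mu0_even]
  convert (hasMoments_mu0_odd m n k).D1 (n := n) using 1
  ring

/-- recurrence relation for the first sequence. -/
theorem stmt_13 (m n : ℕ) (N : ℕ) (hN : 2 ≤ N) :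
    (Even N →
      expVal (mu0 m n N) fa =
        (mass (mu0 m n (N - 1)) : ℚ) / (mass (mu0 m n N) : ℚ) *
          (((m : ℚ) + (n : ℚ) + 1) * expVal (mu0 m n (N - 1)) fa +
            ((m : ℚ) * ((m : ℚ) + 2) +
              ((N : ℚ) - 2) * ((m : ℚ) + (n : ℚ)) * ((m : ℚ) + (n : ℚ) + 2)) / 6)) ∧
    (Odd N →
      expVal (mu0 m n N) fb =
        (mass (mu0 m n (N - 1)) : ℚ) / (mass (mu0 m n N) : ℚ) *
          (((m : ℚ) + (n : ℚ) + 1) * expVal (mu0 m n (N - 1)) fb +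
            ((m : ℚ) * ((m : ℚ) + 2) +
              ((N : ℚ) - 2) * ((m : ℚ) + (n : ℚ)) * ((m : ℚ) + (n : ℚ) + 2)) / 6)) := by
  constructor
  · rintro ⟨k, rfl⟩
    obtain ⟨k, rfl⟩ : ∃ j, k = j + 1 := ⟨k - 1, by omega⟩
    have h := hasMoments_mu0_odd m n k
    have h0 := h.mass_ne_zero
    rw [show k + 1 + (k + 1) - 1 = 2 * k + 1 by omega, show k + 1 + (k + 1) = 2 * k + 2 by omega,
      expVal_eq_pairing, expVal_eq_pairing, mu0_even, h.pairing_D1_fa]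
    field_simp
    push_cast
    ring
  · rintro ⟨k, rfl⟩
    obtain ⟨k, rfl⟩ : ∃ j, k = j + 1 := ⟨k - 1, by omega⟩
    have h := hasMoments_mu0_even m n k
    have h0 := h.mass_ne_zero
    rw [show 2 * (k + 1) + 1 - 1 = 2 * k + 2 by omega, expVal_eq_pairing, expVal_eq_pairing,
      mu0_odd, mul_add_one, h.pairing_D0_fb]
    field_simp
    push_cast
    ring
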